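/- Let d ≥ 2, let (m_n) be a regular sequence with Σ_{n=1}^∞ m_n^{−1/n} = ∞ (so the class C(m_n) is quasianalytic), and let h be a homogeneous Hamiltonian on T'ℝ^d which belongs to C(m_n, D) for every open set D with compact closure contained in T'ℝ^d, and whose flow Φ is complete. If there exist T > 0 and a point (y₀, η₀) ∈ T'ℝ^d which is absolutely T-periodic, then every point of T'ℝ^d is T-periodic. -/

import Mathlib

open Real Set Filter MeasureTheory
open scoped BigOperators Topology

noncomputable section

/-- A sequence `(m n)` (indexed from 1) of positive reals is *regular* if it is nondecreasing,
grows faster than any power of `n`, satisfies `m (n+1) / m n ≤ n * C ^ n`, and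
`n ↦ log (m n / n!)` is convex. -/
def RegularSeq (m : ℕ → ℝ) : Prop :=
  (∀ n : ℕ, 1 ≤ n → 0 < m n) ∧
  (∀ n : ℕ, 1 ≤ n → m n ≤ m (n + 1)) ∧
  (∀ k : ℕ, Filter.Tendsto (fun n : ℕ => m n / (n : ℝ) ^ k) Filter.atTop Filter.atTop) ∧
  (∃ C : ℝ, 0 < C ∧ ∀ n : ℕ, 1 ≤ n → m (n + 1) / m n ≤ (n : ℝ) * C ^ n) ∧
  (∀ n : ℕ, 1 ≤ n →
    Real.log (m (n + 1) / (Nat.factorial (n + 1) : ℝ)) ≤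
      (Real.log (m n / (Nat.factorial n : ℝ)) +
        Real.log (m (n + 2) / (Nat.factorial (n + 2) : ℝ))) / 2)

/-- `u` belongs to the Carleman class `C(m_n, D)`: it is `C^∞` on `D` and there is `C > 0`
with `‖∂^α u‖ ≤ C^{|α|} m_{|α|}` on `D` for every order `|α| ≥ 1`. -/
def CarlemanClass {E F : Type*} [NormedAddCommGroup E] [NormedSpace ℝ E]
    [NormedAddCommGroup F] [NormedSpace ℝ F]
    (m : ℕ → ℝ) (D : Set E) (u : E → F) : Prop :=
  ContDiffOn ℝ (⊤ : ℕ∞) u D ∧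
  ∃ C : ℝ, 0 < C ∧ ∀ n : ℕ, 1 ≤ n → ∀ x ∈ D,
    ‖iteratedFDerivWithin ℝ n u D x‖ ≤ C ^ n * m n

/-- The phase space `ℝ^d × ℝ^d`. -/
abbrev Phase (d : ℕ) := (Fin d → ℝ) × (Fin d → ℝ)

/-- `T'ℝ^d = ℝ^d × (ℝ^d ∖ {0})`. -/
def Tprime (d : ℕ) : Set (Phase d) := {p | p.2 ≠ 0}

/-- The Hamiltonian vector field `(∂h/∂ξ, −∂h/∂x)` of `h`. -/
def hamField {d : ℕ} (h : Phase d → ℝ) (p : Phase d) : Phase d :=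
  (fun j => fderiv ℝ h p (0, Pi.single j 1), fun j => - fderiv ℝ h p (Pi.single j 1, 0))

/-- `γ` solves Hamilton's equations `ẋ = h_ξ`, `ξ̇ = −h_x` on the set `I`. -/
def IsHamTrajOn {d : ℕ} (h : Phase d → ℝ) (γ : ℝ → Phase d) (I : Set ℝ) : Prop :=
  ∀ t ∈ I, HasDerivAt γ (hamField h (γ t)) t

/-- `h` is a homogeneous Hamiltonian: smooth and positive on `T'ℝ^d`, and positively
homogeneous of degree 1 in `ξ`. -/
def HomHamiltonian {d : ℕ} (h : Phase d → ℝ) : Prop :=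
  ContDiffOn ℝ (⊤ : ℕ∞) h (Tprime d) ∧
  (∀ p ∈ Tprime d, 0 < h p) ∧
  (∀ p ∈ Tprime d, ∀ c : ℝ, 0 < c → h (p.1, c • p.2) = c * h p)

/-- `Φ` is the complete flow of `h` on `T'ℝ^d`: it is smooth in `(t, y, η)`, starts at the
identity, stays in `T'ℝ^d`, solves Hamilton's equations for all time, and is the unique such
trajectory through each point. -/
def IsCompleteFlow {d : ℕ} (h : Phase d → ℝ) (Φ : ℝ → Phase d → Phase d) : Prop :=
  ContDiffOn ℝ (⊤ : ℕ∞) (fun q : ℝ × Phase d => Φ q.1 q.2) (Set.univ ×ˢ Tprime d) ∧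
  ∀ p ∈ Tprime d,
    Φ 0 p = p ∧ (∀ t : ℝ, Φ t p ∈ Tprime d) ∧
    IsHamTrajOn h (fun t => Φ t p) Set.univ ∧
    (∀ γ : ℝ → Phase d, γ 0 = p → (∀ t : ℝ, γ t ∈ Tprime d) →
      IsHamTrajOn h γ Set.univ → γ = fun t => Φ t p)

/-- The function `(y, η) ↦ |x*(T; y, η) − y|² + |ξ*(T; y, η) − η|²`. -/
def periodDefect {d : ℕ} (Φ : ℝ → Phase d → Phase d) (T : ℝ) (p : Phase d) : ℝ :=
  (∑ j, ((Φ T p).1 j - p.1 j) ^ 2) + (∑ j, ((Φ T p).2 j - p.2 j) ^ 2)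

/-- `p₀ ∈ T'ℝ^d` is absolutely `T`-periodic: the period defect vanishes to infinite
order at `p₀`. -/
def AbsPeriodic {d : ℕ} (Φ : ℝ → Phase d → Phase d) (T : ℝ) (p₀ : Phase d) : Prop :=
  p₀ ∈ Tprime d ∧
  ∀ n : ℕ, iteratedFDerivWithin ℝ n (periodDefect Φ T) (Tprime d) p₀ = 0


lemma qa_bang_step {E : Type*} [NormedAddCommGroup E] [NormedSpace ℝ E]
    (f : ℕ → ℝ → E) (M : ℕ → ℝ) (Mpos : ∀ n, 0 < M n)
    (Mlc : ∀ n, M (n+1) / M n ≤ M (n+2) / M (n+1))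
    (hder : ∀ n, ∀ x ∈ Icc (0:ℝ) 1, HasDerivAt (f n) (f (n+1) x) x)
    (bd : ∀ n, ∀ x ∈ Icc (0:ℝ) 1, ‖f n x‖ ≤ M n)
    (N : ℕ) (y x : ℝ) (hy : 0 ≤ y) (hyx : y ≤ x) (hx : x ≤ 1)
    (hxy : x - y ≤ (M N / M (N+1)) / exp 1)
    (hS : ∀ j, ‖f j y‖ ≤ exp (-(N+1:ℝ)) * (exp j * M j)) :
    ∀ j, ‖f j x‖ ≤ exp (-(N:ℝ)) * (exp j * M j) := by
  have hmono : Monotone (fun n => M (n+1) / M n) := monotone_nat_of_le_succ Mlc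
  set μ := M (N+1) / M N with hμ
  have hμpos : 0 < μ := div_pos (Mpos _) (Mpos _)
  -- main claim
  have claim : ∀ i j : ℕ, N + 1 ≤ j + i → ∀ z ∈ Icc y 1,
      ‖f j z‖ ≤ exp (-(N+1:ℝ)) * (exp j * M j) * exp (exp 1 * μ * (z - y)) := by
    intro i
    induction i with
    | zero =>
      intro j hj z hz
      have h1 := bd j z ⟨hy.trans hz.1, hz.2⟩
      have h2 : 1 ≤ exp (-(N+1:ℝ)) * exp j := by
        rw [← exp_add]; apply one_le_exp
        have : ((N+1:ℕ):ℝ) ≤ j := by exact_mod_cast hj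
        push_cast at this; linarith
      have h3 : 1 ≤ exp (exp 1 * μ * (z - y)) := one_le_exp (by
        have := hz.1
        have : 0 ≤ z - y := by linarith
        positivity)
      have h4 := Mpos j
      calc ‖f j z‖ ≤ M j := h1
        _ = 1 * M j * 1 := by ring
        _ ≤ (exp (-(N+1:ℝ)) * exp j) * M j * exp (exp 1 * μ * (z - y)) := by gcongr
        _ = _ := by ring
    | succ i ih =>
      intro j hj z hz
      by_cases hjN : N + 1 ≤ j
      · exact ih j (by omega) z hz
      have hj' : j ≤ N := by omega
      have key := image_norm_le_of_norm_deriv_right_le_deriv_boundary (f := f j) (f' := f (j+1))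
        (a := y) (b := 1)
        (B := fun z => exp (-(N+1:ℝ)) * (exp j * M j) * exp (exp 1 * μ * (z - y)))
        (B' := fun z => exp (-(N+1:ℝ)) * (exp j * M j) * (exp (exp 1 * μ * (z - y)) * (exp 1 * μ)))
        (fun z hz => (hder j z ⟨hy.trans hz.1, hz.2⟩).continuousAt.continuousWithinAt)
        (fun z hz => (hder j z ⟨hy.trans hz.1, hz.2.le⟩).hasDerivWithinAt)
        (by simpa using hS j)
        (by
          intro z
          have h1 : HasDerivAt (fun z => exp 1 * μ * (z - y)) (exp 1 * μ) z := by
            simpa using ((hasDerivAt_id z).sub_const y).const_mul (exp 1 * μ)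
          exact h1.exp.const_mul _)
        (by
          intro z hz
          refine (ih (j+1) (by omega) z ⟨hz.1, hz.2.le⟩).trans ?_
          have h5 : M (j+1) ≤ μ * M j := by
            have := hmono hj'
            simp only at this
            rwa [div_le_iff₀ (Mpos j)] at this
          have h6 : exp ((j+1:ℕ):ℝ) = exp j * exp 1 := by push_cast; rw [exp_add]
          rw [h6]
          calc _ ≤ exp (-(N+1:ℝ)) * (exp j * exp 1 * (μ * M j)) * exp (exp 1 * μ * (z - y)) := by
                gcongr
            _ = _ := by ring)
      exact key hz
  intro j
  refine (claim (N+1) j (by omega) x ⟨hyx, hx⟩).trans ?_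
  have h1 : exp 1 * μ * (x - y) ≤ 1 := by
    calc exp 1 * μ * (x - y) ≤ exp 1 * μ * ((M N / M (N+1)) / exp 1) := by gcongr
      _ = 1 := by
        rw [hμ]; have := (Mpos N).ne'; have := (Mpos (N+1)).ne'; field_simp
  have h2 := exp_le_exp.2 h1
  have h4 := Mpos j
  calc _ ≤ exp (-(N+1:ℝ)) * (exp j * M j) * exp 1 := by gcongr
    _ = (exp (-(N+1:ℝ)) * exp 1) * (exp j * M j) := by ring
    _ = _ := by rw [← exp_add]; congr 2; ring

lemma qa_bang {E : Type*} [NormedAddCommGroup E] [NormedSpace ℝ E]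
    (f : ℕ → ℝ → E) (M : ℕ → ℝ) (Mpos : ∀ n, 0 < M n)
    (Mlc : ∀ n, M (n+1) / M n ≤ M (n+2) / M (n+1))
    (hder : ∀ n, ∀ x ∈ Icc (0:ℝ) 1, HasDerivAt (f n) (f (n+1) x) x)
    (bd : ∀ n, ∀ x ∈ Icc (0:ℝ) 1, ‖f n x‖ ≤ M n)
    (hz : ∀ n, f n 0 = 0)
    (hdiv : ¬ Summable (fun n => M n / M (n+1))) :
    ∀ x ∈ Icc (0:ℝ) 1, f 0 x = 0 := by
  have claim : ∀ i k : ℕ, ∀ x ∈ Icc (0:ℝ) 1,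
      x ≤ ∑ l ∈ Finset.Ico k (k+i), (M l / M (l+1)) / exp 1 →
      ∀ j, ‖f j x‖ ≤ exp (-(k:ℝ)) * (exp j * M j) := by
    intro i
    induction i with
    | zero =>
      intro k x hx hx' j
      have : x = 0 := le_antisymm (by simpa using hx') hx.1
      have := Mpos j
      subst x
      rw [hz, norm_zero]; positivity
    | succ i ih =>
      intro k x hx hx'
      rw [Finset.sum_eq_sum_Ico_succ_bot (by omega)] at hx'
      have e : k + (i+1) = k + 1 + i := by ring
      rw [e] at hx'
      set σ := ∑ l ∈ Finset.Ico (k+1) (k+1+i), (M l / M (l+1)) / exp 1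
      have hσ : 0 ≤ σ := Finset.sum_nonneg (fun l _ => by
        have := Mpos l; have := Mpos (l+1); positivity)
      have hq : 0 ≤ M k / M (k+1) / exp 1 := by
        have := Mpos k; have := Mpos (k+1); positivity
      refine qa_bang_step f M Mpos Mlc hder bd k (min x σ) x (le_min hx.1 hσ) (min_le_left _ _) hx.2
        ?_ ?_
      · rcases min_cases x σ with h | h <;> rw [h.1] <;> linarith
      · have := ih (k+1) (min x σ) ⟨le_min hx.1 hσ, (min_le_left _ _).trans hx.2⟩ (min_le_right _ _)
        simpa using this
  intro x hx
  have hk : ∀ k : ℕ, ‖f 0 x‖ ≤ exp (-(k:ℝ)) * M 0 := by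
    intro k
    have hns : ¬ Summable (fun l => (M (l+k) / M (l+k+1)) / exp 1) := by
      intro h
      apply hdiv
      have h2 := h.mul_right (exp 1)
      simp only [div_mul_cancel₀ _ (exp_pos 1).ne'] at h2
      exact (summable_nat_add_iff k (f := fun n => M n / M (n+1))).1 h2
    have ht := (not_summable_iff_tendsto_nat_atTop_of_nonneg (fun l => by
      have := Mpos (l+k); have := Mpos (l+k+1); positivity)).1 hns
    obtain ⟨i, hi⟩ := (ht.eventually_ge_atTop 1).exists
    have := claim i k x hx (by
      rw [Finset.sum_Ico_eq_sum_range]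
      simp only [add_tsub_cancel_left]
      refine hx.2.trans (hi.trans (le_of_eq (Finset.sum_congr rfl fun l _ => ?_)))
      rw [add_comm l k]) 0
    simpa using this
  have hlim : Tendsto (fun k : ℕ => exp (-(k:ℝ)) * M 0) atTop (𝓝 (0 * M 0)) :=
    (Real.tendsto_exp_neg_atTop_nhds_zero.comp tendsto_natCast_atTop_atTop).mul_const _
  rw [zero_mul] at hlim
  have := ge_of_tendsto' hlim hk
  exact norm_le_zero_iff.1 this

lemma qa_carleman_ineq (b : ℕ → ℝ) (hb : ∀ k, 0 < b k) (hs : Summable b) :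
    Summable (fun n : ℕ => (∏ k ∈ Finset.range (n+1), b k) ^ ((1:ℝ)/(n+1:ℝ))) := by
  set S : ℕ → ℝ := fun n => ∑ k ∈ Finset.range n, ((k:ℝ)+1) * b k with hS
  have hS0 : ∀ n, 0 ≤ S n := fun n => Finset.sum_nonneg fun k _ => by have := hb k; positivity
  have tel : ∀ N, ∑ n ∈ Finset.range N, 2 * S (n+1) * (1/((n:ℝ)+1) - 1/((n:ℝ)+2))
      + 2 * S N / ((N:ℝ)+1) = 2 * ∑ k ∈ Finset.range N, b k := by
    intro N
    induction N with
    | zero => simp [hS]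
    | succ N ih =>
      rw [Finset.sum_range_succ, Finset.sum_range_succ _ N, mul_add, ← ih]
      have : S (N+1) = S N + ((N:ℝ)+1) * b N := by simp [hS, Finset.sum_range_succ]
      rw [this]; push_cast
      have h1 : (N:ℝ)+1 ≠ 0 := by positivity
      have h2 : (N:ℝ)+2 ≠ 0 := by positivity
      have h3 : (N:ℝ)+1+1 ≠ 0 := by positivity
      field_simp
      ring
  have sumT : Summable (fun n : ℕ => 2 * S (n+1) * (1/((n:ℝ)+1) - 1/((n:ℝ)+2))) := by
    refine summable_of_sum_range_le (c := 2 * ∑' k, b k) (fun n => ?_) (fun N => ?_)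
    · have := hS0 (n+1)
      have h2 : 1/((n:ℝ)+2) ≤ 1/((n:ℝ)+1) := by gcongr; norm_num
      have : 0 ≤ 1/((n:ℝ)+1) - 1/((n:ℝ)+2) := by linarith
      positivity
    · have h1 := tel N
      have h2 : 0 ≤ 2 * S N / ((N:ℝ)+1) := by have := hS0 N; positivity
      have h3 := hs.sum_le_tsum (Finset.range N) (fun i _ => (hb i).le)
      linarith
  refine Summable.of_nonneg_of_le (fun n => ?_) (fun n => ?_) (sumT.mul_left (exp 1))
  · exact rpow_nonneg (Finset.prod_nonneg fun k _ => (hb k).le) _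
  · -- AM-GM
    have hn : (0:ℝ) < (n:ℝ)+1 := by positivity
    have hP : 0 < ∏ k ∈ Finset.range (n+1), b k := Finset.prod_pos fun k _ => hb k
    have amgm := Real.geom_mean_le_arith_mean (Finset.range (n+1)) (fun _ => (1:ℝ))
      (fun k => ((k:ℝ)+1) * b k) (fun _ _ => zero_le_one) (by simp; positivity)
      (fun k _ => by have := hb k; positivity)
    simp only [rpow_one, Finset.sum_const, Finset.card_range, nsmul_eq_mul, mul_one, one_mul,
      Finset.prod_mul_distrib] at amgm
    have hfac : ∏ k ∈ Finset.range (n+1), ((k:ℝ)+1) = ((n+1).factorial : ℝ) := by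
      rw [← Finset.prod_range_add_one_eq_factorial]; push_cast; rfl
    rw [hfac, mul_rpow (by positivity) hP.le] at amgm
    push_cast at amgm
    have hst : ((n:ℝ)+1) / exp 1 ≤ (((n+1).factorial : ℝ)) ^ (((n:ℝ)+1)⁻¹) := by
      have h1 : (((n:ℝ)+1) / exp 1) ^ (n+1) ≤ ((n+1).factorial : ℝ) := by
        have := Real.pow_div_factorial_le_exp ((n:ℝ)+1) hn.le (n+1)
        rw [div_le_iff₀ (by positivity)] at this
        rw [div_pow, div_le_iff₀ (by positivity), ← exp_nat_mul]
        push_cast; rw [mul_one, mul_comm]; exact this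
      calc ((n:ℝ)+1) / exp 1 = ((((n:ℝ)+1) / exp 1) ^ (n+1)) ^ (((n:ℝ)+1)⁻¹) := by
            rw [← rpow_natCast, ← rpow_mul (by positivity)]
            push_cast; rw [mul_inv_cancel₀ hn.ne', rpow_one]
        _ ≤ _ := by gcongr
    have hG : 0 ≤ (∏ k ∈ Finset.range (n+1), b k) ^ (((n:ℝ)+1)⁻¹) := rpow_nonneg hP.le _
    have h2 : ((n:ℝ)+1) / exp 1 * (∏ k ∈ Finset.range (n+1), b k) ^ (((n:ℝ)+1)⁻¹)
        ≤ S (n+1) / ((n:ℝ)+1) := le_trans (by gcongr) amgm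
    rw [one_div]
    have h3 : (∏ k ∈ Finset.range (n+1), b k) ^ (((n:ℝ)+1)⁻¹)
        ≤ exp 1 * (S (n+1) / ((n:ℝ)+1)^2) := by
      have h4 := mul_le_mul_of_nonneg_left h2 (show 0 ≤ exp 1 / ((n:ℝ)+1) by positivity)
      calc _ = exp 1 / ((n:ℝ)+1) * (((n:ℝ)+1) / exp 1 * (∏ k ∈ Finset.range (n+1), b k) ^ (((n:ℝ)+1)⁻¹)) := by
            field_simp
        _ ≤ _ := h4
        _ = _ := by field_simp
    refine h3.trans ?_
    gcongr
    have h5 : 2 * (1/((n:ℝ)+1) - 1/((n:ℝ)+2)) = 2 / (((n:ℝ)+1)*((n:ℝ)+2)) := by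
      field_simp; ring
    have h6 : 1/((n:ℝ)+1)^2 ≤ 2 / (((n:ℝ)+1)*((n:ℝ)+2)) := by
      rw [div_le_div_iff₀ (by positivity) (by positivity)]
      nlinarith [(Nat.cast_nonneg n : (0:ℝ) ≤ n)]
    calc S (n+1) / ((n:ℝ)+1)^2 = S (n+1) * (1/((n:ℝ)+1)^2) := by ring
      _ ≤ S (n+1) * (2 / (((n:ℝ)+1)*((n:ℝ)+2))) := mul_le_mul_of_nonneg_left h6 (hS0 _)
      _ = _ := by rw [← h5]; ring

lemma qa_not_summable (m : ℕ → ℝ) (mpos : ∀ n, 0 < m (n+1))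
    (hqa : ¬ Summable (fun n : ℕ => (m (n + 1)) ^ (-(1 : ℝ) / (n + 1 : ℝ)))) :
    ¬ Summable (fun n : ℕ => m (n+1) / m (n+2)) := by
  intro hs
  apply hqa
  set b : ℕ → ℝ := fun k => Nat.casesOn k (1 / m 1) (fun k => m (k+1) / m (k+2)) with hb
  have hb0 : ∀ k, 0 < b k := by
    intro k
    cases k with
    | zero => exact one_div_pos.2 (mpos 0)
    | succ k => exact div_pos (mpos k) (mpos (k+1))
  have hbs : Summable b := (summable_nat_add_iff 1).1 hs
  have hprod : ∀ n, ∏ k ∈ Finset.range (n+1), b k = 1 / m (n+1) := by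
    intro n
    induction n with
    | zero => simp [hb]
    | succ n ih =>
      rw [Finset.prod_range_succ, ih]
      simp only [hb]
      have := (mpos n).ne'
      field_simp
  refine (qa_carleman_ineq b hb0 hbs).congr fun n => ?_
  rw [hprod, neg_div, rpow_neg (mpos n).le, one_div (m (n+1)), inv_rpow (mpos n).le]

def qaW : ℕ → ℝ
  | 0 => 1
  | 1 => 1
  | (n+2) => (2*(n:ℝ)+1) * qaW (n+1)

lemma qaW_pos : ∀ n, 0 < qaW n
  | 0 => by simp [qaW]
  | 1 => by simp [qaW]
  | (n+2) => by have := qaW_pos (n+1); simp only [qaW]; positivity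

lemma qaW_succ (n : ℕ) (hn : 1 ≤ n) : qaW (n+1) = (2*(n:ℝ)-1) * qaW n := by
  obtain ⟨k, rfl⟩ : ∃ k, n = k+1 := ⟨n-1, by omega⟩
  simp only [qaW]; push_cast; ring

lemma qaW_le (n : ℕ) : qaW n ≤ 2^n * (n.factorial : ℝ) := by
  induction n with
  | zero => simp [qaW]
  | succ n ih =>
    rcases Nat.eq_zero_or_pos n with rfl | hn
    · simp [qaW]
    · rw [qaW_succ n hn, Nat.factorial_succ, pow_succ]
      push_cast
      have := qaW_pos n
      have h1 : (1:ℝ) ≤ n := by exact_mod_cast hn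
      calc _ ≤ (2 * ((n:ℝ)+1)) * (2^n * (n.factorial:ℝ)) := by
            apply mul_le_mul _ ih this.le (by positivity); linarith
        _ = _ := by ring

lemma qa_sum_partSize {n : ℕ} (c : OrderedFinpartition n) : ∑ i, (c.partSize i : ℝ) = n := by
  have := c.sum_sigma_eq_sum (fun _ => (1:ℝ))
  simpa using this

lemma qa_prod_extendLeft {n : ℕ} (c : OrderedFinpartition n) (g : ℕ → ℝ) :
    ∏ i, g (c.extendLeft.partSize i) = g 1 * ∏ i, g (c.partSize i) := by
  change ∏ i : Fin (c.length + 1), g ((Fin.cons 1 c.partSize : Fin (c.length+1) → ℕ) i) = _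
  rw [Fin.prod_univ_succ]
  simp

lemma qa_prod_extendMiddle {n : ℕ} (c : OrderedFinpartition n) (k : Fin c.length) (g : ℕ → ℝ)
    (r : ℝ) (hr : g (c.partSize k + 1) = r * g (c.partSize k)) :
    ∏ i, g ((c.extendMiddle k).partSize i) = r * ∏ i, g (c.partSize i) := by
  change ∏ i : Fin c.length, g (Function.update c.partSize k (c.partSize k + 1) i) = _
  rw [← Finset.mul_prod_erase _ _ (Finset.mem_univ k),
    ← Finset.mul_prod_erase (a := k) _ (fun i => g (c.partSize i)) (Finset.mem_univ k)]
  simp only [Function.update_self, hr, mul_assoc]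
  congr 2
  refine Finset.prod_congr rfl fun i hi => ?_
  rw [Function.update_of_ne (Finset.ne_of_mem_erase hi)]

lemma qa_comb (n : ℕ) : ∑ c : OrderedFinpartition n,
    ((c.length.factorial : ℝ) * ∏ i, qaW (c.partSize i)) = qaW (n+1) := by
  induction n with
  | zero =>
    rw [Fintype.sum_unique]
    simp [qaW]
  | succ n ih =>
    rw [← (OrderedFinpartition.extendEquiv n).sum_comp, Fintype.sum_sigma]
    simp only [Fintype.sum_option]
    have : ∀ c : OrderedFinpartition n,
        (c.extendLeft.length.factorial : ℝ) * ∏ i, qaW (c.extendLeft.partSize i) +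
        ∑ k : Fin c.length, ((c.extendMiddle k).length.factorial : ℝ) *
          ∏ i, qaW ((c.extendMiddle k).partSize i)
        = (2*(n:ℝ)+1) * ((c.length.factorial : ℝ) * ∏ i, qaW (c.partSize i)) := by
      intro c
      rw [qa_prod_extendLeft]
      have h1 : ∀ k : Fin c.length, ((c.extendMiddle k).length.factorial : ℝ) *
          ∏ i, qaW ((c.extendMiddle k).partSize i) =
          (2*(c.partSize k : ℝ) - 1) * ((c.length.factorial : ℝ) * ∏ i, qaW (c.partSize i)) := by
        intro k
        rw [qa_prod_extendMiddle c k qaW _ (qaW_succ _ (c.partSize_pos k))]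
        simp only [OrderedFinpartition.extendMiddle_length]
        ring
      simp only [h1]
      rw [← Finset.sum_mul, Finset.sum_sub_distrib, ← Finset.mul_sum, qa_sum_partSize]
      simp only [OrderedFinpartition.extendLeft_length, Nat.factorial_succ, qaW]
      simp
      ring
    rw [show qaW (n+1+1) = (2*(n:ℝ)+1) * qaW (n+1) from rfl, ← ih, Finset.mul_sum]
    exact Finset.sum_congr rfl fun c _ => this c

lemma qa_logconv (M : ℕ → ℝ) (Mpos : ∀ n, 1 ≤ n → 0 < M n) (M1 : M 1 = 1)
    (Mlc : ∀ j n, 1 ≤ j → j ≤ n → M (j+1) / M j ≤ M (n+1) / M n) (n : ℕ) (hn : 1 ≤ n) :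
    ∀ c : OrderedFinpartition n, M c.length * ∏ i, M (c.partSize i) ≤ M n := by
  induction n, hn using Nat.le_induction with
  | base =>
    intro c
    have h1 : c.length = 1 := le_antisymm c.length_le (c.length_pos one_pos)
    have h2 : ∀ i, c.partSize i = 1 := fun i => le_antisymm (c.partSize_le i) (c.partSize_pos i)
    simp [h1, h2, M1]
  | succ n hn ih =>
    intro c
    obtain ⟨⟨c, o⟩, rfl⟩ := (OrderedFinpartition.extendEquiv n).surjective c
    have hc := ih c
    have hP : 0 < ∏ i, M (c.partSize i) :=
      Finset.prod_pos fun i _ => Mpos _ (c.partSize_pos i)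
    have hl : 1 ≤ c.length := c.length_pos hn
    have key : ∀ r, 0 ≤ r → r ≤ M (n+1) / M n → r * (M c.length * ∏ i, M (c.partSize i)) ≤ M (n+1) := by
      intro r hr0 hr
      have hMn := Mpos n hn
      have := Mpos c.length hl
      calc _ ≤ M (n+1) / M n * M n := by
            apply mul_le_mul hr hc (by positivity) (hr0.trans hr)
        _ = _ := by field_simp
    cases o with
    | none =>
      change M c.extendLeft.length * ∏ i, M (c.extendLeft.partSize i) ≤ _
      rw [qa_prod_extendLeft, M1, one_mul]
      have h := key (M (c.length+1) / M c.length)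
        (div_pos (Mpos _ (by omega)) (Mpos _ hl)).le (Mlc _ _ hl c.length_le)
      have := (Mpos _ hl).ne'
      rw [← mul_assoc, div_mul_cancel₀ _ this] at h
      simpa using h
    | some k =>
      have hk := c.partSize_pos k
      change M (c.extendMiddle k).length * ∏ i, M ((c.extendMiddle k).partSize i) ≤ _
      rw [qa_prod_extendMiddle c k M
        (M (c.partSize k + 1) / M (c.partSize k)) (by have := (Mpos _ hk).ne'; field_simp)]
      have h := key (M (c.partSize k+1) / M (c.partSize k))
        (div_pos (Mpos _ (by omega)) (Mpos _ hk)).le (Mlc _ _ hk (c.partSize_le k))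
      simp only [OrderedFinpartition.extendMiddle_length]
      linarith

lemma qa_two_le : (2 : WithTop ℕ∞) ≤ ((⊤ : ℕ∞) : WithTop ℕ∞) := by
  have : ((2:ℕ∞) : WithTop ℕ∞) ≤ ((⊤ : ℕ∞) : WithTop ℕ∞) := WithTop.coe_le_coe.2 le_top
  exact this

lemma qa_comp_bound {E : Type*} [NormedAddCommGroup E] [NormedSpace ℝ E]
    (M : ℕ → ℝ) (Mpos : ∀ n, 1 ≤ n → 0 < M n) (M1 : M 1 = 1)
    (Mlc : ∀ j n, 1 ≤ j → j ≤ n → M (j+1) / M j ≤ M (n+1) / M n)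
    (C R : ℝ) (hC : 0 < C) (hR : 0 ≤ R)
    (V : E → E) (f : ℝ → E) (s : ℝ) (n : ℕ) (hn : 1 ≤ n)
    (hV : ContDiffAt ℝ (⊤ : ℕ∞) V (f s)) (hf : ContDiffAt ℝ (⊤ : ℕ∞) f s)
    (bV : ∀ k, 1 ≤ k → ‖iteratedFDeriv ℝ k V (f s)‖ ≤ C^k * (k.factorial * M k))
    (bf : ∀ j, 1 ≤ j → j ≤ n → ‖iteratedDeriv j f s‖ ≤ C⁻¹ * (M j * qaW j) * R^j) :
    ‖iteratedDeriv n (V ∘ f) s‖ ≤ M n * qaW (n+1) * R^n := by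
  rw [iteratedDeriv_vcomp_eq_sum_orderedFinpartition hV hf (by exact_mod_cast le_top)]
  refine (norm_sum_le _ _).trans ?_
  rw [← qa_comb n, Finset.mul_sum, Finset.sum_mul]
  refine Finset.sum_le_sum fun c _ => ?_
  refine (ContinuousMultilinearMap.le_opNorm _ _).trans ?_
  have hl : 1 ≤ c.length := c.length_pos hn
  have h1 : ∏ i, ‖iteratedDeriv (c.partSize i) f s‖ ≤
      ∏ i, (C⁻¹ * (M (c.partSize i) * qaW (c.partSize i)) * R^(c.partSize i)) :=
    Finset.prod_le_prod (fun _ _ => norm_nonneg _)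
      (fun i _ => bf _ (c.partSize_pos i) (c.partSize_le i))
  have hR' : ∏ i, R ^ (c.partSize i) = R ^ n := by
    rw [Finset.prod_pow_eq_pow_sum]
    congr 1
    have := qa_sum_partSize c
    exact_mod_cast this
  have hMp := Mpos _ hl
  refine (mul_le_mul (bV _ hl) h1 (Finset.prod_nonneg fun _ _ => norm_nonneg _)
    (by positivity)).trans ?_
  rw [Finset.prod_mul_distrib, Finset.prod_mul_distrib, Finset.prod_mul_distrib, hR']
  simp only [Finset.prod_const, Finset.card_univ, Fintype.card_fin]
  have hW : 0 ≤ ∏ i, qaW (c.partSize i) := Finset.prod_nonneg fun i _ => (qaW_pos _).le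
  have hlc := qa_logconv M Mpos M1 Mlc n hn c
  calc _ = (C * C⁻¹)^c.length * ((M c.length * ∏ i, M (c.partSize i)) *
        (c.length.factorial * ∏ i, qaW (c.partSize i)) * R^n) := by rw [mul_pow]; ring
    _ = ((M c.length * ∏ i, M (c.partSize i)) *
        (c.length.factorial * ∏ i, qaW (c.partSize i)) * R^n) := by
      rw [mul_inv_cancel₀ hC.ne', one_pow, one_mul]
    _ ≤ _ := by gcongr

lemma qa_slice_smooth {E : Type*} [NormedAddCommGroup E] [NormedSpace ℝ E]
    (U : Set ℝ) (hU : IsOpen U) (ψ : ℝ → ℝ → E)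
    (hψ : ContDiffOn ℝ (⊤ : ℕ∞) (fun q : ℝ × ℝ => ψ q.1 q.2) (univ ×ˢ U)) (t s : ℝ) (hs : s ∈ U) :
    ContDiffAt ℝ (⊤ : ℕ∞) (fun q : ℝ × ℝ => ψ q.1 q.2) (t, s) :=
  hψ.contDiffAt ((isOpen_univ.prod hU).mem_nhds ⟨mem_univ _, hs⟩)

lemma qa_deriv_slice {E : Type*} [NormedAddCommGroup E] [NormedSpace ℝ E]
    (ψ : ℝ → ℝ → E) (t s : ℝ)
    (hψ : DifferentiableAt ℝ (fun q : ℝ × ℝ => ψ q.1 q.2) (t, s)) :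
    HasDerivAt (ψ t) (fderiv ℝ (fun q : ℝ × ℝ => ψ q.1 q.2) (t, s) (0, 1)) s ∧
    HasDerivAt (fun t => ψ t s) (fderiv ℝ (fun q : ℝ × ℝ => ψ q.1 q.2) (t, s) (1, 0)) t := by
  constructor
  · exact hψ.hasFDerivAt.comp_hasDerivAt s ((hasDerivAt_const s t).prodMk (hasDerivAt_id s))
  · exact HasFDerivAt.comp_hasDerivAt (f := fun t => (t, s)) t hψ.hasFDerivAt
      ((hasDerivAt_id t).prodMk (hasDerivAt_const t s))

lemma qa_deriv_smooth {E : Type*} [NormedAddCommGroup E] [NormedSpace ℝ E]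
    (U : Set ℝ) (hU : IsOpen U) (ψ : ℝ → ℝ → E)
    (hψ : ContDiffOn ℝ (⊤ : ℕ∞) (fun q : ℝ × ℝ => ψ q.1 q.2) (univ ×ˢ U)) :
    ContDiffOn ℝ (⊤ : ℕ∞) (fun q : ℝ × ℝ => deriv (ψ q.1) q.2) (univ ×ˢ U) := by
  have hO : IsOpen ((univ : Set ℝ) ×ˢ U) := isOpen_univ.prod hU
  have h1 : ContDiffOn ℝ (⊤ : ℕ∞) (fun q => fderiv ℝ (fun q : ℝ × ℝ => ψ q.1 q.2) q (0,1))
      (univ ×ˢ U) :=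
    (hψ.fderiv_of_isOpen hO (by simp)).clm_apply contDiffOn_const
  refine h1.congr fun q hq => ?_
  exact (qa_deriv_slice ψ q.1 q.2
    ((qa_slice_smooth U hU ψ hψ q.1 q.2 hq.2).differentiableAt (by simp))).1.deriv

lemma qa_mixed {E : Type*} [NormedAddCommGroup E] [NormedSpace ℝ E]
    (U : Set ℝ) (hU : IsOpen U) (n : ℕ) : ∀ (ψ χ : ℝ → ℝ → E)
    (_ : ContDiffOn ℝ (⊤ : ℕ∞) (fun q : ℝ × ℝ => ψ q.1 q.2) (univ ×ˢ U))
    (_ : ContDiffOn ℝ (⊤ : ℕ∞) (fun q : ℝ × ℝ => χ q.1 q.2) (univ ×ˢ U))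
    (_ : ∀ t, ∀ s ∈ U, HasDerivAt (fun t => ψ t s) (χ t s) t),
    ∀ t, ∀ s ∈ U, HasDerivAt (fun t => iteratedDeriv n (ψ t) s) (iteratedDeriv n (χ t) s) t := by
  induction n with
  | zero => intro ψ χ hψ hχ h; simpa using h
  | succ n ih =>
    intro ψ χ hψ hχ h
    simp only [iteratedDeriv_succ']
    refine ih (fun t => deriv (ψ t)) (fun t => deriv (χ t)) (qa_deriv_smooth U hU ψ hψ)
      (qa_deriv_smooth U hU χ hχ) ?_
    intro t s hs
    have hO : IsOpen ((univ : Set ℝ) ×ˢ U) := isOpen_univ.prod hU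
    set Ψ : ℝ × ℝ → E := fun q : ℝ × ℝ => ψ q.1 q.2 with hΨ
    have hq : ContDiffAt ℝ (⊤ : ℕ∞) Ψ (t, s) := qa_slice_smooth U hU ψ hψ t s hs
    have hd : DifferentiableAt ℝ (fderiv ℝ Ψ) (t, s) :=
      ((hq.fderiv_right (m := 1) (by rw [one_add_one_eq_two]; exact qa_two_le))).differentiableAt (by simp)
    have hsym : IsSymmSndFDerivAt ℝ Ψ (t, s) := hq.isSymmSndFDerivAt (by simpa using qa_two_le)
    have hev : ∀ t', ∀ s' ∈ U, DifferentiableAt ℝ Ψ (t', s') := fun t' s' hs' =>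
      (qa_slice_smooth U hU ψ hψ t' s' hs').differentiableAt (by simp)
    -- left side
    have e1 : (fun t => deriv (ψ t) s) = fun t => fderiv ℝ Ψ (t, s) (0,1) := by
      funext t'
      exact (qa_deriv_slice ψ t' s (hev t' s hs)).1.deriv
    have d1 : HasDerivAt (fun t => fderiv ℝ Ψ (t, s) (0,1))
        (fderiv ℝ (fderiv ℝ Ψ) (t, s) (1,0) (0,1)) t := by
      have := HasFDerivAt.comp_hasDerivAt (f := fun t => (t, s)) t hd.hasFDerivAt
        ((hasDerivAt_id t).prodMk (hasDerivAt_const t s))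
      exact ((ContinuousLinearMap.apply ℝ E ((0:ℝ),(1:ℝ))).hasFDerivAt.comp_hasDerivAt t this)
    have e2 : deriv (χ t) s = fderiv ℝ (fderiv ℝ Ψ) (t, s) (0,1) (1,0) := by
      have : χ t =ᶠ[𝓝 s] fun s => fderiv ℝ Ψ (t, s) (1,0) := by
        filter_upwards [hU.mem_nhds hs] with s' hs'
        exact (h t s' hs').unique (qa_deriv_slice ψ t s' (hev t s' hs')).2
      rw [this.deriv_eq]
      have := HasFDerivAt.comp_hasDerivAt (f := fun s => (t, s)) s hd.hasFDerivAt
        ((hasDerivAt_const s t).prodMk (hasDerivAt_id s))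
      exact ((ContinuousLinearMap.apply ℝ E ((1:ℝ),(0:ℝ))).hasFDerivAt.comp_hasDerivAt s this).deriv
    rw [e1, e2, hsym.eq]
    exact d1

lemma qa_iter_affine {E : Type*} [NormedAddCommGroup E] [NormedSpace ℝ E] (p v : E) (n : ℕ)
    (s : ℝ) : iteratedDeriv (n+1) (fun s : ℝ => p + s • v) s = if n = 0 then v else 0 := by
  rw [iteratedDeriv_succ']
  have : deriv (fun s : ℝ => p + s • v) = fun _ => v := by
    funext s
    have : HasDerivAt (fun s : ℝ => p + s • v) ((1:ℝ) • v) s :=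
      ((hasDerivAt_id s).smul_const v).const_add p
    simpa using this.deriv
  rw [this, iteratedDeriv_const]

lemma qa_ode {E : Type*} [NormedAddCommGroup E] [NormedSpace ℝ E]
    (M : ℕ → ℝ) (Mpos : ∀ n, 1 ≤ n → 0 < M n) (M1 : M 1 = 1)
    (Mlc : ∀ j n, 1 ≤ j → j ≤ n → M (j+1) / M j ≤ M (n+1) / M n)
    (U : Set ℝ) (hU : IsOpen U) (Ω : Set E) (hΩ : IsOpen Ω)
    (V : E → E) (hV : ContDiffOn ℝ (⊤ : ℕ∞) V Ω)
    (ψ : ℝ → ℝ → E) (hψ : ContDiffOn ℝ (⊤ : ℕ∞) (fun q : ℝ × ℝ => ψ q.1 q.2) (univ ×ˢ U))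
    (hmap : ∀ t, ∀ s ∈ U, ψ t s ∈ Ω)
    (hder : ∀ t, ∀ s ∈ U, HasDerivAt (fun t => ψ t s) (V (ψ t s)) t)
    (p v : E) (h0 : ∀ s ∈ U, ψ 0 s = p + s • v)
    (C E0 T : ℝ) (hC : 0 < C) (hE0 : 0 < E0) (hE : C * ‖v‖ ≤ E0) (s : ℝ) (hs : s ∈ U)
    (bV : ∀ t ∈ Icc 0 T, ∀ k, 1 ≤ k →
      ‖iteratedFDeriv ℝ k V (ψ t s)‖ ≤ C^k * (k.factorial * M k)) (n : ℕ) (hn : 1 ≤ n) :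
    ∀ t ∈ Icc 0 T, ‖iteratedDeriv n (ψ t) s‖ ≤
      C⁻¹ * (M n * qaW n) * (E0 * exp (2 * C * t))^n := by
  have hχ : ContDiffOn ℝ (⊤ : ℕ∞) (fun q : ℝ × ℝ => (V ∘ ψ q.1) q.2) (univ ×ˢ U) :=
    hV.comp hψ (fun q hq => hmap _ _ hq.2)
  induction n using Nat.strong_induction_on with
  | _ n ih =>
  have hmix := qa_mixed U hU n ψ (fun t => V ∘ ψ t) hψ hχ hder
  have hBd : ∀ t : ℝ, HasDerivAt (fun t => C⁻¹ * (M n * qaW n) * (E0 * exp (2 * C * t))^n)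
      (C⁻¹ * (M n * qaW n) * (2 * C * n * (E0 * exp (2 * C * t))^n)) t := by
    intro t
    have e : (fun t => C⁻¹ * (M n * qaW n) * (E0 * exp (2 * C * t))^n) =
        fun t => C⁻¹ * (M n * qaW n) * (E0^n * exp (2 * C * n * t)) := by
      funext t
      rw [mul_pow, ← exp_nat_mul]; congr 3; ring_nf
    rw [e, mul_pow, ← exp_nat_mul]
    have h1 : HasDerivAt (fun t : ℝ => 2 * C * n * t) (2 * C * n) t := by
      simpa using (hasDerivAt_id t).const_mul (2 * C * (n:ℝ))
    refine ((h1.exp.const_mul (E0^n)).const_mul (C⁻¹ * (M n * qaW n))).congr_deriv ?_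
    rw [show (n:ℝ) * (2 * C * t) = 2 * C * n * t by ring]
    ring
  have hMn := Mpos n hn
  have hWn := qaW_pos n
  intro t ht
  refine image_norm_le_of_norm_deriv_right_lt_deriv_boundary (a := 0) (b := T)
    (f := fun t => iteratedDeriv n (ψ t) s)
    (f' := fun t => iteratedDeriv n (V ∘ ψ t) s)
    (fun t _ => (hmix t s hs).continuousAt.continuousWithinAt)
    (fun t _ => (hmix t s hs).hasDerivWithinAt) ?_ hBd ?_ ht
  · have : ψ 0 =ᶠ[𝓝 s] fun s => p + s • v := by
      filter_upwards [hU.mem_nhds hs] with s' hs' using h0 s' hs'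
    rw [this.iteratedDeriv_eq n]
    obtain ⟨k, rfl⟩ : ∃ k, n = k+1 := ⟨n-1, by omega⟩
    rw [qa_iter_affine]
    split_ifs with hk
    · subst hk
      simp [M1, qaW]
      rw [← div_eq_inv_mul, le_div_iff₀ hC]; linarith
    · rw [norm_zero]; positivity
  · intro t ht heq
    have ht' : t ∈ Icc 0 T := ⟨ht.1, ht.2.le⟩
    have hE' : 0 < E0 * exp (2 * C * t) := by positivity
    have hb := qa_comp_bound M Mpos M1 Mlc C (E0 * exp (2 * C * t)) hC hE'.le V (ψ t) s n hn
      (hV.contDiffAt (hΩ.mem_nhds (hmap t s hs)))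
      ((qa_slice_smooth U hU ψ hψ t s hs).comp (g := fun q : ℝ × ℝ => ψ q.1 q.2) s (contDiffAt_const.prodMk contDiffAt_id))
      (bV t ht') (by
        intro j hj hjn
        rcases hjn.lt_or_eq with h | h
        · exact ih j h hj t ht'
        · subst h; exact heq.le)
    refine hb.trans_lt ?_
    rw [qaW_succ n hn]
    have : C⁻¹ * (M n * qaW n) * (2 * C * n * (E0 * exp (2 * C * t))^n) =
      M n * (2 * n * qaW n) * (E0 * exp (2 * C * t))^n := by field_simp
    rw [this]
    gcongr
    linarith

lemma qa_iter_hasDeriv {E : Type*} [NormedAddCommGroup E] [NormedSpace ℝ E]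
    (U : Set ℝ) (hU : IsOpen U) (f : ℝ → E) (hf : ContDiffOn ℝ (⊤ : ℕ∞) f U) (n : ℕ) :
    ContDiffOn ℝ (⊤ : ℕ∞) (iteratedDeriv n f) U ∧
    ∀ s ∈ U, HasDerivAt (iteratedDeriv n f) (iteratedDeriv (n+1) f s) s := by
  have h1 : ContDiffOn ℝ (⊤ : ℕ∞) (iteratedDeriv n f) U := by
    induction n with
    | zero => simpa using hf
    | succ n ih => rw [iteratedDeriv_succ]; exact ih.deriv_of_isOpen hU (by simp)
  refine ⟨h1, fun s hs => ?_⟩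
  rw [iteratedDeriv_succ]
  exact ((h1.contDiffAt (hU.mem_nhds hs)).differentiableAt (by simp)).hasDerivAt

lemma qa_iter_clm {E : Type*} [NormedAddCommGroup E] [NormedSpace ℝ E]
    (f : ℝ → E) (x : ℝ) (hf : ContDiffAt ℝ (⊤ : ℕ∞) f x) (l : E →L[ℝ] ℝ) (n : ℕ) :
    iteratedDeriv n (fun s => l (f s)) x = l (iteratedDeriv n f x) := by
  have := l.iteratedFDeriv_comp_left hf (i := n) (by exact_mod_cast le_top)
  simp only [iteratedDeriv]
  change iteratedFDeriv ℝ n (l ∘ f) x _ = _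
  rw [this]; rfl

lemma qa_sos {ι : Type*} [Fintype ι] (g : ι → ℝ → ℝ) (hg : ∀ i, ContDiffAt ℝ (⊤ : ℕ∞) (g i) 0)
    (h : ∀ k, iteratedDeriv k (fun s => ∑ i, g i s ^ 2) 0 = 0) (n : ℕ) :
    ∀ i, iteratedDeriv n (g i) 0 = 0 := by
  have hcd : ∀ (k : ℕ) i, ContDiffAt ℝ k (g i) 0 := fun k i =>
    (hg i).of_le (by exact_mod_cast le_top)
  induction n using Nat.strong_induction_on with
  | _ n ih =>
  have h1 := h (2*n)
  have e : (fun s => ∑ i, g i s ^ 2) = fun s => ∑ i, g i s * g i s := by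
    funext s; simp [sq]
  rw [e, iteratedDeriv_fun_sum (fun i _ => (hcd _ i).mul (hcd _ i))] at h1
  have h2 : ∀ i, iteratedDeriv (2*n) (fun s => g i s * g i s) 0 =
      ((2*n).choose n : ℝ) * (iteratedDeriv n (g i) 0)^2 := by
    intro i
    rw [iteratedDeriv_fun_mul (hcd _ i) (hcd _ i), Finset.sum_eq_single n]
    · rw [show 2*n-n = n by omega]; ring
    · intro k hk hkn
      rcases lt_or_gt_of_ne hkn with hlt | hgt
      · rw [ih k hlt i]; simp
      · have := Finset.mem_range.1 hk
        rw [ih (2*n-k) (by omega) i]; simp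
    · intro hh; simp at hh; omega
  simp only [h2] at h1
  rw [Finset.sum_eq_zero_iff_of_nonneg (fun i _ => by positivity)] at h1
  intro i
  have h3 := h1 i (Finset.mem_univ i)
  have h4 : ((2*n).choose n : ℝ) ≠ 0 := by
    exact_mod_cast (Nat.choose_pos (by omega)).ne'
  simpa [h4] using h3

def qaM (m : ℕ → ℝ) (n : ℕ) : ℝ := m n / (n.factorial * m 1)

lemma qaM_pos (m : ℕ → ℝ) (hm : RegularSeq m) (n : ℕ) (hn : 1 ≤ n) : 0 < qaM m n := by
  have := hm.1 n hn
  have := hm.1 1 le_rfl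
  unfold qaM; positivity

lemma qaM_one (m : ℕ → ℝ) (hm : RegularSeq m) : qaM m 1 = 1 := by
  have := (hm.1 1 le_rfl).ne'
  simp [qaM, this]

lemma qaM_fac (m : ℕ → ℝ) (hm : RegularSeq m) (n : ℕ) : n.factorial * qaM m n = m n / m 1 := by
  have := (hm.1 1 le_rfl).ne'
  have : (n.factorial : ℝ) ≠ 0 := by positivity
  unfold qaM; field_simp

lemma qaM_lc (m : ℕ → ℝ) (hm : RegularSeq m) (j n : ℕ) (hj : 1 ≤ j) (hn : j ≤ n) :
    qaM m (j+1) / qaM m j ≤ qaM m (n+1) / qaM m n := by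
  induction n, hn using Nat.le_induction with
  | base => exact le_rfl
  | succ n hn ih =>
    refine ih.trans ?_
    have hn1 : 1 ≤ n := hj.trans hn
    have h := hm.2.2.2.2 n hn1
    have p0 := hm.1 n hn1
    have p1 := hm.1 (n+1) (by omega)
    have p2 := hm.1 (n+2) (by omega)
    have f0 : (0:ℝ) < n.factorial := by positivity
    have f1 : (0:ℝ) < (n+1).factorial := by positivity
    have f2 : (0:ℝ) < (n+2).factorial := by positivity
    have q1 := hm.1 1 le_rfl
    have e : ∀ k, qaM m k = m k / k.factorial / m 1 := by intro k; rw [qaM, div_div]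
    rw [e, e, e]
    set a := m n / n.factorial
    set b := m (n+1) / (n+1).factorial
    set c := m (n+2) / (n+2).factorial
    have ha : 0 < a := by positivity
    have hb : 0 < b := by positivity
    have hc : 0 < c := by positivity
    have h2 : Real.log (b*b) ≤ Real.log (a*c) := by
      rw [Real.log_mul hb.ne' hb.ne', Real.log_mul ha.ne' hc.ne']; linarith
    have h3 := (Real.log_le_log_iff (by positivity) (by positivity)).1 h2
    rw [div_div_div_cancel_right₀ q1.ne', div_div_div_cancel_right₀ q1.ne',
      div_le_div_iff₀ ha hb]
    change b * b ≤ c * a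
    linarith

lemma qa_m_lc (m : ℕ → ℝ) (hm : RegularSeq m) (n : ℕ) (hn : 1 ≤ n) :
    m (n+1) / m n ≤ m (n+2) / m (n+1) := by
  have q1 := hm.1 1 le_rfl
  have e : ∀ k, 1 ≤ k → m (k+1) / m k = (k+1) * (qaM m (k+1) / qaM m k) := by
    intro k hk
    have := (hm.1 k hk).ne'
    have : (k.factorial : ℝ) ≠ 0 := by positivity
    rw [qaM, qaM, Nat.factorial_succ]; push_cast
    field_simp
  rw [e n hn, e (n+1) (by omega)]
  have h := qaM_lc m hm n (n+1) hn (by omega)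
  have := div_pos (qaM_pos m hm (n+1) (by omega)) (qaM_pos m hm n hn)
  push_cast
  gcongr
  linarith

lemma qa_m_ge (m : ℕ → ℝ) (hm : RegularSeq m) (n : ℕ) (hn : 1 ≤ n) : m 1 ≤ m n := by
  induction n, hn using Nat.le_induction with
  | base => exact le_rfl
  | succ n hn ih => exact ih.trans (hm.2.1 n hn)

def qaL (d : ℕ) : (Phase d →L[ℝ] ℝ) →L[ℝ] Phase d :=
  ContinuousLinearMap.prod
    (ContinuousLinearMap.pi fun j => ContinuousLinearMap.apply ℝ ℝ ((0, Pi.single j 1) : Phase d))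
    (ContinuousLinearMap.pi fun j =>
      - ContinuousLinearMap.apply ℝ ℝ ((Pi.single j 1, 0) : Phase d))

lemma qa_hamField {d : ℕ} (h : Phase d → ℝ) : hamField h = qaL d ∘ fderiv ℝ h := by
  funext p
  rfl

lemma qa_V_bound {d : ℕ} (m : ℕ → ℝ) (hm : RegularSeq m) (h : Phase d → ℝ) (D : Set (Phase d))
    (hD : IsOpen D) (hC : CarlemanClass m D h) :
    ∃ C : ℝ, 0 < C ∧ ∀ k : ℕ, 1 ≤ k → ∀ x ∈ D,
      ‖iteratedFDeriv ℝ k (hamField h) x‖ ≤ C^k * (k.factorial * qaM m k) := by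
  obtain ⟨hs, A, hA, hb⟩ := hC
  obtain ⟨C0, hC0, hr⟩ := hm.2.2.2.1
  have q1 := hm.1 1 le_rfl
  set Q := ‖qaL d‖ * A * m 1 + 1 with hQ
  have hQ1 : 1 ≤ Q := by
    have : 0 ≤ ‖qaL d‖ * A * m 1 := by positivity
    linarith
  refine ⟨Q * (2 * A * C0), by positivity, fun k hk x hx => ?_⟩
  have hfd : ContDiffAt ℝ (⊤ : ℕ∞) (fderiv ℝ h) x :=
    (hs.contDiffAt (hD.mem_nhds hx)).fderiv_right (by simp)
  rw [qa_hamField]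
  refine ((qaL d).norm_iteratedFDeriv_comp_left hfd (by exact_mod_cast le_top)).trans ?_
  rw [norm_iteratedFDeriv_fderiv, ← iteratedFDerivWithin_of_isOpen (k+1) hD hx, qaM_fac m hm]
  have h1 := hb (k+1) (by omega) x hx
  have hmk := hm.1 k hk
  have h2 : m (k+1) ≤ 2^k * C0^k * m k := by
    have := hr k hk
    rw [div_le_iff₀ hmk] at this
    refine this.trans ?_
    have : (k:ℝ) ≤ 2^k := by exact_mod_cast (Nat.lt_two_pow_self (n := k)).le
    gcongr
  have h3 : ‖qaL d‖ * A * m 1 ≤ Q^k := by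
    calc _ ≤ Q := by linarith
      _ = Q^1 := by ring
      _ ≤ Q^k := pow_le_pow_right₀ hQ1 hk
  calc _ ≤ ‖qaL d‖ * (A^(k+1) * (2^k * C0^k * m k)) := by gcongr; exact h1.trans (by gcongr)
    _ = (‖qaL d‖ * A * m 1) * ((2 * A * C0)^k * (m k / m 1)) := by
      rw [mul_pow, mul_pow, pow_succ]; field_simp
    _ ≤ Q^k * ((2 * A * C0)^k * (m k / m 1)) := by gcongr
    _ = _ := by rw [mul_pow]; ring

lemma qa_Tprime_open (d : ℕ) : IsOpen (Tprime d) := by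
  have : Tprime d = (fun p : Phase d => p.2) ⁻¹' {0}ᶜ := by ext p; simp [Tprime]
  rw [this]
  exact isOpen_compl_singleton.preimage continuous_snd

lemma qa_ham_smooth {d : ℕ} (h : Phase d → ℝ) (hh : ContDiffOn ℝ (⊤ : ℕ∞) h (Tprime d)) :
    ContDiffOn ℝ (⊤ : ℕ∞) (hamField h) (Tprime d) := by
  rw [qa_hamField]
  exact (qaL d).contDiff.comp_contDiffOn (hh.fderiv_of_isOpen (qa_Tprime_open d) (by simp))

lemma qa_vanish {d : ℕ} (Φ : ℝ → Phase d → Phase d) (T : ℝ) (p₀ v : Phase d)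
    (hp₀ : AbsPeriodic Φ T p₀) (hs : ContDiffOn ℝ (⊤ : ℕ∞) (Φ T) (Tprime d)) (n : ℕ) :
    iteratedDeriv n (fun s : ℝ => Φ T (p₀ + s • v) - (p₀ + s • v)) 0 = 0 := by
  have hO := qa_Tprime_open d
  have hΦ : ContDiffAt ℝ (⊤ : ℕ∞) (Φ T) p₀ := hs.contDiffAt (hO.mem_nhds hp₀.1)
  have haff : ContDiff ℝ (⊤ : ℕ∞) (fun s : ℝ => p₀ + s • v) := by fun_prop
  have hf : ContDiffAt ℝ (⊤ : ℕ∞) (fun s : ℝ => Φ T (p₀ + s • v) - (p₀ + s • v)) 0 := by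
    refine ContDiffAt.sub ?_ haff.contDiffAt
    refine ContDiffAt.comp (g := Φ T) (f := fun s : ℝ => p₀ + s • v) 0 ?_ haff.contDiffAt
    simpa using hΦ
  let l : Fin d ⊕ Fin d → (Phase d →L[ℝ] ℝ) := Sum.elim
    (fun j => (ContinuousLinearMap.proj j).comp (ContinuousLinearMap.fst ℝ _ _))
    (fun j => (ContinuousLinearMap.proj j).comp (ContinuousLinearMap.snd ℝ _ _))
  have hpd : periodDefect Φ T = fun p => ∑ i, (l i (Φ T p - p))^2 := by
    funext p
    simp [periodDefect, l, Fintype.sum_sum_type]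
  have hpds : ContDiffAt ℝ (⊤ : ℕ∞) (periodDefect Φ T) p₀ := by
    rw [hpd]
    refine ContDiffAt.sum fun i _ => ?_
    exact ((l i).contDiff.contDiffAt.comp p₀ (hΦ.sub contDiffAt_id)).pow 2
  have hz : ∀ k, iteratedDeriv k (periodDefect Φ T ∘ fun s : ℝ => p₀ + s • v) 0 = 0 := by
    intro k
    rw [iteratedDeriv_vcomp_eq_sum_orderedFinpartition (n := (⊤ : ℕ∞)) (by simpa using hpds)
      haff.contDiffAt (by exact_mod_cast le_top)]
    refine Finset.sum_eq_zero fun c _ => ?_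
    have : iteratedFDeriv ℝ c.length (periodDefect Φ T) p₀ = 0 := by
      rw [← iteratedFDerivWithin_of_isOpen _ hO hp₀.1]; exact hp₀.2 _
    simp [this]
  have hall := qa_sos (fun i s => l i (Φ T (p₀ + s • v) - (p₀ + s • v)))
    (fun i => (l i).contDiff.contDiffAt.comp 0 hf)
    (fun k => by
      have := hz k
      rw [hpd] at this
      exact this) n
  simp only [qa_iter_clm _ _ hf] at hall
  refine Prod.ext ?_ ?_
  · funext j; exact hall (Sum.inl j)
  · funext j; exact hall (Sum.inr j)

lemma qa_segment {d : ℕ} (m : ℕ → ℝ) (hm : RegularSeq m)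
    (hqa : ¬ Summable (fun n : ℕ => (m (n + 1)) ^ (-(1 : ℝ) / (n + 1 : ℝ))))
    (h : Phase d → ℝ) (hh : HomHamiltonian h)
    (hhC : ∀ D : Set (Phase d), IsOpen D → IsCompact (closure D) → closure D ⊆ Tprime d →
      CarlemanClass m D h)
    (Φ : ℝ → Phase d → Phase d) (hΦ : IsCompleteFlow h Φ)
    (T : ℝ) (hT : 0 < T) (p₀ : Phase d) (hp₀ : AbsPeriodic Φ T p₀) (v : Phase d)
    (hseg : ∀ s ∈ Icc (0:ℝ) 1, p₀ + s • v ∈ Tprime d) : Φ T (p₀ + v) = p₀ + v := by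
  have hO := qa_Tprime_open d
  have haff : ContDiff ℝ (⊤ : ℕ∞) (fun s : ℝ => p₀ + s • v) := by fun_prop
  set U : Set ℝ := (fun s : ℝ => p₀ + s • v) ⁻¹' Tprime d with hUdef
  have hU : IsOpen U := hO.preimage haff.continuous
  have hIU : Icc (0:ℝ) 1 ⊆ U := hseg
  set ψ : ℝ → ℝ → Phase d := fun t s => Φ t (p₀ + s • v) with hψdef
  have hψ : ContDiffOn ℝ (⊤ : ℕ∞) (fun q : ℝ × ℝ => ψ q.1 q.2) (univ ×ˢ U) := by
    have h1 : ContDiff ℝ (⊤ : ℕ∞) (fun q : ℝ × ℝ => (q.1, p₀ + q.2 • v)) := by fun_prop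
    exact hΦ.1.comp h1.contDiffOn (fun q hq => ⟨mem_univ _, hq.2⟩)
  have hmap : ∀ t, ∀ s ∈ U, ψ t s ∈ Tprime d := fun t s hs => (hΦ.2 _ hs).2.1 t
  have hder : ∀ t, ∀ s ∈ U, HasDerivAt (fun t => ψ t s) (hamField h (ψ t s)) t :=
    fun t s hs => (hΦ.2 _ hs).2.2.1 t (mem_univ _)
  have h0 : ∀ s ∈ U, ψ 0 s = p₀ + s • v := fun s hs => (hΦ.2 _ hs).1
  have hK : IsCompact ((fun q : ℝ × ℝ => ψ q.1 q.2) '' (Icc 0 T ×ˢ Icc 0 1)) :=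
    (isCompact_Icc.prod isCompact_Icc).image_of_continuousOn
      (hψ.continuousOn.mono (prod_mono (subset_univ _) hIU))
  have hKT : ((fun q : ℝ × ℝ => ψ q.1 q.2) '' (Icc 0 T ×ˢ Icc 0 1)) ⊆ Tprime d := by
    rintro _ ⟨q, hq, rfl⟩
    exact hmap _ _ (hIU hq.2)
  obtain ⟨D, hDo, hKD, hDT, hDc⟩ := exists_open_between_and_isCompact_closure hK hO hKT
  obtain ⟨C, hC, hVb⟩ := qa_V_bound m hm h D hDo (hhC D hDo hDc hDT)
  have hVs := qa_ham_smooth h hh.1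
  have q1 := hm.1 1 le_rfl
  set E0 := C * ‖v‖ + 1 with hE0d
  have hE0 : 0 < E0 := by positivity
  have hode : ∀ s ∈ Icc (0:ℝ) 1, ∀ n, 1 ≤ n → ‖iteratedDeriv n (ψ T) s‖ ≤
      C⁻¹ * (qaM m n * qaW n) * (E0 * exp (2 * C * T))^n := by
    intro s hs n hn
    exact qa_ode (qaM m) (qaM_pos m hm) (qaM_one m hm) (qaM_lc m hm) U hU (Tprime d) hO
      (hamField h) hVs ψ hψ hmap hder p₀ v h0 C E0 T hC hE0 (by linarith) s (hIU hs)
      (fun t ht k hk => hVb k hk _ (hKD ⟨(t, s), ⟨ht, hs⟩, rfl⟩)) n hn T ⟨hT.le, le_rfl⟩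
  set R := E0 * exp (2 * C * T) with hR
  have hRp : 0 < R := by positivity
  have hψT : ContDiffOn ℝ (⊤ : ℕ∞) (ψ T) U := by
    have h1 : ContDiff ℝ (⊤ : ℕ∞) (fun s : ℝ => (T, s)) := by fun_prop
    exact hψ.comp h1.contDiffOn (fun q hq => ⟨mem_univ _, hq⟩)
  set f : ℝ → Phase d := fun s => Φ T (p₀ + s • v) - (p₀ + s • v) with hfd
  have hf : ContDiffOn ℝ (⊤ : ℕ∞) f U := hψT.sub haff.contDiffOn
  set K := (C⁻¹ / m 1 + ‖v‖ / m 1 + 1) * (2 * R + 1) with hKd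
  have hKp : 0 < K := by positivity
  have hfb : ∀ s ∈ Icc (0:ℝ) 1, ∀ n, 1 ≤ n → ‖iteratedDeriv n f s‖ ≤ K^n * m n := by
    intro s hs n hn
    have hmn := hm.1 n hn
    have e : iteratedDeriv n f s = iteratedDeriv n (ψ T) s -
        iteratedDeriv n (fun s : ℝ => p₀ + s • v) s :=
      iteratedDeriv_fun_sub
        ((hψT.contDiffAt (hU.mem_nhds (hIU hs))).of_le (by exact_mod_cast le_top))
        (haff.contDiffAt.of_le (by exact_mod_cast le_top))
    have e1 : ‖iteratedDeriv n (ψ T) s‖ ≤ (C⁻¹ / m 1) * (2 * R)^n * m n := by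
      refine (hode s hs n hn).trans ?_
      have hq := qaM_pos m hm n hn
      calc _ ≤ C⁻¹ * (qaM m n * (2^n * n.factorial)) * R^n := by
            gcongr; exact qaW_le n
        _ = C⁻¹ * (n.factorial * qaM m n) * (2 * R)^n := by rw [mul_pow 2 R]; ring
        _ = _ := by rw [qaM_fac m hm]; ring
    have e2 : ‖iteratedDeriv n (fun s : ℝ => p₀ + s • v) s‖ ≤ (‖v‖ / m 1) * m n := by
      have h3 : ‖v‖ ≤ (‖v‖ / m 1) * m n := by
        rw [div_mul_eq_mul_div, le_div_iff₀ q1]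
        exact mul_le_mul_of_nonneg_left (qa_m_ge m hm n hn) (norm_nonneg v)
      obtain ⟨k, rfl⟩ := Nat.exists_eq_add_of_le' hn
      rw [qa_iter_affine]
      split_ifs
      · exact h3
      · simp; positivity
    set a := C⁻¹ / m 1 with ha
    set b := ‖v‖ / m 1 with hb
    have ha0 : 0 ≤ a := by positivity
    have hb0 : 0 ≤ b := by positivity
    have h4 : (2*R)^n ≤ (2*R+1)^n := by gcongr; linarith
    have h5 : 1 ≤ (2*R+1)^n := one_le_pow₀ (by linarith)
    have h6 : a + b + 1 ≤ (a+b+1)^n := le_self_pow₀ (by linarith) (by omega)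
    rw [e]
    calc _ ≤ a * (2*R)^n * m n + b * m n := (norm_sub_le _ _).trans (add_le_add e1 e2)
      _ ≤ a * (2*R+1)^n * m n + b * (2*R+1)^n * m n := by
        gcongr
        nlinarith
      _ ≤ (a + b + 1) * (2*R+1)^n * m n := by
        have : 0 ≤ (2*R+1)^n * m n := by positivity
        linarith
      _ ≤ (a + b + 1)^n * (2*R+1)^n * m n := by gcongr
      _ = _ := by rw [hKd, mul_pow]
  have hv : ∀ n, iteratedDeriv n f 0 = 0 := by
    have hs : ContDiffOn ℝ (⊤ : ℕ∞) (Φ T) (Tprime d) := by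
      have h1 : ContDiff ℝ (⊤ : ℕ∞) (fun p : Phase d => (T, p)) := by fun_prop
      exact hΦ.1.comp h1.contDiffOn (fun q hq => ⟨mem_univ _, hq⟩)
    exact fun n => qa_vanish Φ T p₀ v hp₀ hs n
  have hrat : ∀ n, K^(n+1+1) * m (n+1+1) / (K^(n+1) * m (n+1)) = K * (m (n+2) / m (n+1)) := by
    intro n
    have := (hm.1 (n+1) (by omega)).ne'
    rw [pow_succ K (n+1)]
    field_simp
  have hbang := qa_bang (fun n => iteratedDeriv (n+1) f) (fun n => K^(n+1) * m (n+1))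
    (fun n => mul_pos (pow_pos hKp _) (hm.1 _ (by omega)))
    (fun n => by
      rw [hrat, show n + 2 + 1 = (n+1)+1+1 by ring, hrat]
      exact mul_le_mul_of_nonneg_left (qa_m_lc m hm (n+1) (by omega)) hKp.le)
    (fun n x hx => (qa_iter_hasDeriv U hU f hf (n+1)).2 x (hIU hx))
    (fun n x hx => hfb x hx (n+1) (by omega))
    (fun n => hv (n+1))
    (fun hsum => by
      refine qa_not_summable m (fun n => hm.1 _ (by omega)) hqa ?_
      refine (hsum.mul_left K).congr fun n => ?_
      have h1 := (hm.1 (n+1) (by omega)).ne'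
      have h2 := (hm.1 (n+2) (by omega)).ne'
      change K * (K^(n+1) * m (n+1) / (K^(n+1+1) * m (n+1+1))) = _
      rw [pow_succ K (n+1)]
      field_simp)
  have hconst := constant_of_has_deriv_right_zero (a := 0) (b := 1)
    (hf.continuousOn.mono hIU) (fun x hx => by
      have h1 := (qa_iter_hasDeriv U hU f hf 0).2 x (hIU ⟨hx.1, hx.2.le⟩)
      have h2 := hbang x ⟨hx.1, hx.2.le⟩
      rw [h2, iteratedDeriv_zero] at h1
      exact h1.hasDerivWithinAt) 1 ⟨zero_le_one, le_rfl⟩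
  have hv0 := hv 0
  rw [iteratedDeriv_zero] at hv0
  rw [hv0] at hconst
  simpa [hfd, sub_eq_zero] using hconst


/-- Quasianalytic version of Theorem 4.5′: for a quasianalytic homogeneous Hamiltonian with
complete flow, the existence of one absolutely `T`-periodic point implies that all points
are `T`-periodic. -/
theorem absPeriodic_implies_all_periodic {d : ℕ} (hd : 2 ≤ d)
    (m : ℕ → ℝ) (hm : RegularSeq m)
    (hqa : ¬ Summable (fun n : ℕ => (m (n + 1)) ^ (-(1 : ℝ) / (n + 1 : ℝ))))
    (h : Phase d → ℝ) (hh : HomHamiltonian h)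
    (hhC : ∀ D : Set (Phase d), IsOpen D → IsCompact (closure D) → closure D ⊆ Tprime d →
      CarlemanClass m D h)
    (Φ : ℝ → Phase d → Phase d) (hΦ : IsCompleteFlow h Φ)
    (T : ℝ) (hT : 0 < T) (p₀ : Phase d) (hp₀ : AbsPeriodic Φ T p₀) :
    ∀ p ∈ Tprime d, Φ T p = p := by
  obtain hO := qa_Tprime_open d
  have key : ∀ p : Phase d, (∀ s ∈ Icc (0:ℝ) 1, (1 - s) • p₀.2 + s • p.2 ≠ 0) → Φ T p = p := by
    intro p hp
    have := qa_segment m hm hqa h hh hhC Φ hΦ T hT p₀ hp₀ (p - p₀) (fun s hs => by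
      have h1 := hp s hs
      simp only [Tprime, Set.mem_ofPred_eq]
      intro h2
      apply h1
      rw [← h2]
      simp only [Prod.snd_add, Prod.smul_snd, Prod.snd_sub]
      module)
    simpa using this
  have hp0 : p₀.2 ≠ 0 := hp₀.1
  intro p hp
  have hp2 : p.2 ≠ 0 := hp
  by_cases hpar : ∃ c : ℝ, p.2 = c • p₀.2
  · obtain ⟨c, hc⟩ := hpar
    have hw : ∃ w : Fin d → ℝ, ∀ a : ℝ, w ≠ a • p₀.2 := by
      by_contra hcon
      push Not at hcon
      have h1 : Module.finrank ℝ (Fin d → ℝ) ≤ 1 :=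
        finrank_le_one p₀.2 (fun w => by obtain ⟨a, ha⟩ := hcon w; exact ⟨a, ha.symm⟩)
      simp at h1
      omega
    obtain ⟨w, hw⟩ := hw
    have hlim : Tendsto (fun n : ℕ => p + (1 / ((n:ℝ) + 1)) • ((0, w) : Phase d)) atTop (𝓝 p) := by
      have := (tendsto_one_div_add_atTop_nhds_zero_nat (𝕜 := ℝ)).smul_const ((0, w) : Phase d)
      simpa using this.const_add p
    have hper : ∀ n : ℕ, Φ T (p + (1 / ((n:ℝ) + 1)) • ((0, w) : Phase d)) =
        p + (1 / ((n:ℝ) + 1)) • ((0, w) : Phase d) := by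
      intro n
      apply key
      intro s hs h1
      have he : (1 / ((n:ℝ) + 1)) ≠ 0 := by positivity
      set e := (1 / ((n:ℝ) + 1))
      simp only [Prod.snd_add, Prod.smul_snd, hc] at h1
      by_cases hs0 : s = 0
      · simp [hs0] at h1; exact hp0 h1
      · apply hw (-((1 - s) + s * c) / (s * e))
        have h2 : (s * e) • w = (-((1 - s) + s * c)) • p₀.2 := by
          rw [← sub_eq_zero, ← h1]; module
        rw [div_eq_inv_mul, mul_smul, ← h2, smul_smul, inv_mul_cancel₀ (by positivity), one_smul]
    have hcont : ContinuousAt (Φ T) p := by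
      have h1 : ContDiffOn ℝ (⊤ : ℕ∞) (Φ T) (Tprime d) := by
        have h1 : ContDiff ℝ (⊤ : ℕ∞) (fun p : Phase d => (T, p)) := by fun_prop
        exact hΦ.1.comp h1.contDiffOn (fun q hq => ⟨mem_univ _, hq⟩)
      exact h1.continuousOn.continuousAt (hO.mem_nhds hp)
    have h2 := hcont.tendsto.comp hlim
    refine tendsto_nhds_unique h2 (hlim.congr fun n => (hper n).symm)
  · apply key
    intro s hs h1
    by_cases hs0 : s = 0
    · simp [hs0] at h1; exact hp0 h1
    · apply hpar
      refine ⟨-(1 - s) / s, ?_⟩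
      have h2 : s • p.2 = (-(1 - s)) • p₀.2 := by
        rw [← sub_eq_zero, ← h1]; module
      rw [div_eq_inv_mul, mul_smul, ← h2, smul_smul, inv_mul_cancel₀ hs0, one_smul]
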